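/- arXiv:2104.05669 — 6 statements merged into one kernel-verified Lean document; each statement's English description precedes it below -/
import Mathlib

section
/- Let S be a positive semidefinite real d×d matrix, m ∈ ℝ^d, let W be an exponential random variable with rate 1 and let Z be a centered multivariate Gaussian random vector in ℝ^d with covariance matrix S, with W and Z independent. Set Y = W·m + √W·Z. Then for every t ∈ ℝ^d, E[exp(i·⟨t, Y⟩)] = 1 / (1 + ½·tᵀ S t − i·⟨m, t⟩). -/
open MeasureTheory ProbabilityTheory Matrix Complex

/-- The measure `μ` on `ι → ℝ` is the centered multivariate Gaussian measure with
(positive semidefinite) covariance matrix `S`, characterized by its characteristic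
function `t ↦ exp(−½ tᵀ S t)`. -/
def IsCenteredGaussianLaw {ι : Type*} [Fintype ι] (μ : Measure (ι → ℝ))
    (S : Matrix ι ι ℝ) : Prop :=
  IsProbabilityMeasure μ ∧
    ∀ t : ι → ℝ, ∫ x, Complex.exp (Complex.I * ((t ⬝ᵥ x : ℝ) : ℂ)) ∂μ =
      Complex.exp (-(1 / 2 : ℂ) * ((t ⬝ᵥ S.mulVec t : ℝ) : ℂ))

/-- Integration against the exponential law of rate `r` as an integral over `(0, ∞)`. -/
theorem integral_expMeasure {E : Type*} [NormedAddCommGroup E] [NormedSpace ℝ E] {r : ℝ}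
    (hr : 0 < r) (f : ℝ → E) :
    ∫ x, f x ∂(expMeasure r) = ∫ x in Set.Ioi 0, (r * Real.exp (-(r * x))) • f x := by
  have hmeas : Measurable (exponentialPDF r) :=
    (measurable_exponentialPDFReal r).ennreal_ofReal
  change ∫ x, f x ∂(volume.withDensity (exponentialPDF r)) = _
  rw [integral_withDensity_eq_integral_toReal_smul hmeas
      (ae_of_all _ fun _ => ENNReal.ofReal_lt_top),
    ← integral_Ici_eq_integral_Ioi, ← integral_indicator measurableSet_Ici]
  congr 1 with x
  by_cases hx : 0 ≤ x
  · rw [Set.indicator_of_mem (Set.mem_Ici.mpr hx), exponentialPDF_of_nonneg hx,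
      ENNReal.toReal_ofReal (by positivity)]
  · rw [Set.indicator_of_notMem (by simpa using hx), exponentialPDF_of_neg (not_le.mp hx)]
    simp

/-- The complex moment generating function of the exponential law of rate `r`. -/
theorem integral_cexp_mul_expMeasure {r : ℝ} (hr : 0 < r) {c : ℂ} (hc : c.re < r) :
    ∫ x, Complex.exp (c * x) ∂(expMeasure r) = r / (r - c) := by
  have hre : (c - r).re < 0 := by simpa using hc
  have hne : c - r ≠ 0 := fun h => by simp [h] at hre
  have hne' : (r : ℂ) - c ≠ 0 := by rw [← neg_sub]; exact neg_ne_zero.mpr hne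
  have hexp (x : ℝ) : (r * Real.exp (-(r * x))) • Complex.exp (c * x) =
      r * Complex.exp ((c - r) * x) := by
    rw [Complex.real_smul]
    push_cast
    rw [mul_assoc, ← Complex.exp_add]
    ring_nf
  simp_rw [integral_expMeasure hr, hexp]
  rw [integral_const_mul, integral_exp_mul_complex_Ioi hre]
  simp only [ofReal_zero, mul_zero, Complex.exp_zero]
  rw [← neg_sub (r : ℂ) c]
  field_simp

/-- The characteristic function of `w m + √w Z` for a deterministic `w ≥ 0` and a centered
Gaussian vector `Z`. -/
theorem IsCenteredGaussianLaw.integral_cexp_smul_add_sqrt_smul {ι : Type*} [Fintype ι]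
    {μ : Measure (ι → ℝ)} {S : Matrix ι ι ℝ} (hμ : IsCenteredGaussianLaw μ S)
    (m t : ι → ℝ) {w : ℝ} (hw : 0 ≤ w) :
    ∫ z, Complex.exp (Complex.I * ((t ⬝ᵥ (w • m + Real.sqrt w • z) : ℝ) : ℂ)) ∂μ =
      Complex.exp ((Complex.I * ((m ⬝ᵥ t : ℝ) : ℂ)
        - (1 / 2 : ℂ) * ((t ⬝ᵥ S.mulVec t : ℝ) : ℂ)) * w) := by
  have hsplit (z : ι → ℝ) :
      Complex.exp (Complex.I * ((t ⬝ᵥ (w • m + Real.sqrt w • z) : ℝ) : ℂ)) =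
        Complex.exp (Complex.I * ((m ⬝ᵥ t : ℝ) : ℂ) * w) *
          Complex.exp (Complex.I * (((Real.sqrt w • t) ⬝ᵥ z : ℝ) : ℂ)) := by
    rw [← Complex.exp_add, dotProduct_add, dotProduct_smul, dotProduct_smul, smul_dotProduct,
      dotProduct_comm t m]
    simp only [smul_eq_mul]
    push_cast
    ring_nf
  simp_rw [hsplit]
  rw [integral_const_mul, hμ.2, ← Complex.exp_add, mulVec_smul, smul_dotProduct,
    dotProduct_smul, smul_smul, Real.mul_self_sqrt hw, smul_eq_mul]
  push_cast
  ring_nf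

/-- If `W ∼ Exp(1)` and `Z` is a centered Gaussian vector with covariance `S`,
independent of `W`, then `Y = W m + √W Z` has characteristic function
`t ↦ 1 / (1 + ½ tᵀ S t − i ⟨m, t⟩)`. -/
theorem charFun_asymmetric_laplace {Ω : Type*} [MeasurableSpace Ω]
    (P : Measure Ω) [IsProbabilityMeasure P] {d : ℕ}
    (S : Matrix (Fin d) (Fin d) ℝ) (hS : S.PosSemidef) (m : Fin d → ℝ)
    (W : Ω → ℝ) (Z : Ω → Fin d → ℝ) (hWm : Measurable W) (hZm : Measurable Z)
    (hW : P.map W = expMeasure 1)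
    (hZ : IsCenteredGaussianLaw (P.map Z) S)
    (hindep : IndepFun W Z P)
    (Y : Ω → Fin d → ℝ) (hY : Y = fun ω => W ω • m + Real.sqrt (W ω) • Z ω) :
    ∀ t : Fin d → ℝ,
      ∫ ω, Complex.exp (Complex.I * ((t ⬝ᵥ Y ω : ℝ) : ℂ)) ∂P =
        1 / (1 + (1 / 2 : ℂ) * ((t ⬝ᵥ S.mulVec t : ℝ) : ℂ)
          - Complex.I * ((m ⬝ᵥ t : ℝ) : ℂ)) := by
  intro t
  subst hY
  have : IsProbabilityMeasure (P.map W) := Measure.isProbabilityMeasure_map hWm.aemeasurable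
  have : IsProbabilityMeasure (P.map Z) := hZ.1
  have hquad : 0 ≤ t ⬝ᵥ S.mulVec t := by simpa using hS.dotProduct_mulVec_nonneg t
  set F : ℝ × (Fin d → ℝ) → ℂ := fun p =>
    Complex.exp (Complex.I * ((t ⬝ᵥ (p.1 • m + Real.sqrt p.1 • p.2) : ℝ) : ℂ)) with hF
  have hFc : Continuous F := by fun_prop
  have hFi : Integrable F ((P.map W).prod (P.map Z)) :=
    .of_bound hFc.aestronglyMeasurable 1 (ae_of_all _ fun p => by
      simp only [hF, mul_comm Complex.I, Complex.norm_exp_ofReal_mul_I, le_refl])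
  set c : ℂ := Complex.I * ((m ⬝ᵥ t : ℝ) : ℂ)
    - (1 / 2 : ℂ) * ((t ⬝ᵥ S.mulVec t : ℝ) : ℂ) with hc
  have hre : c.re < 1 := by
    have : c.re = -(1 / 2) * (t ⬝ᵥ S.mulVec t) := by simp [hc]
    linarith
  calc ∫ ω, F (W ω, Z ω) ∂P
      = ∫ p, F p ∂((P.map W).prod (P.map Z)) := by
        rw [← hindep.map_prod_eq_prod_map_map hWm.aemeasurable hZm.aemeasurable,
          integral_map (hWm.prodMk hZm).aemeasurable hFc.aestronglyMeasurable]
    _ = ∫ w, ∫ z, F (w, z) ∂(P.map Z) ∂(expMeasure 1) := by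
        rw [integral_prod _ hFi, hW]
    _ = ∫ w, Complex.exp (c * w) ∂(expMeasure 1) := by
        simp_rw [integral_expMeasure one_pos]
        refine setIntegral_congr_fun measurableSet_Ioi fun w hw => ?_
        simp only [hF, hZ.integral_cexp_smul_add_sqrt_smul m t (le_of_lt hw), hc]
    _ = 1 / (1 + (1 / 2 : ℂ) * ((t ⬝ᵥ S.mulVec t : ℝ) : ℂ)
          - Complex.I * ((m ⬝ᵥ t : ℝ) : ℂ)) := by
        rw [integral_cexp_mul_expMeasure one_pos hre, hc, ofReal_one, sub_sub_eq_add_sub]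
end

section
/- Let λ > 0, let S be a positive semidefinite real d×d matrix, m ∈ ℝ^d, let W have the standard Gamma distribution with shape parameter λ (density w^{λ−1}e^{−w}/Γ(λ) on (0,∞)) and let Z be a centered multivariate Gaussian random vector in ℝ^d with covariance matrix S, with W and Z independent. Set Y = W·m + √W·Z. Then for every t ∈ ℝ^d, E[exp(i·⟨t, Y⟩)] = (1 + ½·tᵀ S t − i·⟨m, t⟩)^{−λ}, with the principal complex power. -/
open MeasureTheory ProbabilityTheory Matrix Complex

open Set Filter Topology

lemma measurable_gammaPDF (a r : ℝ) : Measurable (gammaPDF a r) :=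
  (measurable_gammaPDFReal a r).ennreal_ofReal

/-- The moment generating function of the Gamma distribution, to the left of its rate. -/
lemma mgf_id_gammaMeasure {a r t : ℝ} (ha : 0 < a) (hr : 0 < r) (ht : t < r) :
    mgf id (gammaMeasure a r) t = (1 - t / r) ^ (-a) := by
  have hrt : 0 < r - t := sub_pos.2 ht
  have hdens (x : ℝ) : (gammaPDF a r x).toReal • Real.exp (t * x) =
      (Ici (0 : ℝ)).indicator
        (fun x ↦ r ^ a / Real.Gamma a * (x ^ (a - 1) * Real.exp (-((r - t) * x)))) x := by
    rw [gammaPDF, ENNReal.toReal_ofReal (gammaPDFReal_nonneg ha hr x), gammaPDFReal, smul_eq_mul]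
    by_cases hx : 0 ≤ x
    · rw [if_pos hx, indicator_of_mem (mem_Ici.2 hx), mul_assoc, mul_assoc, ← Real.exp_add]
      ring_nf
    · rw [if_neg hx, indicator_of_notMem (by simpa using hx), zero_mul]
  rw [mgf, gammaMeasure, integral_withDensity_eq_integral_toReal_smul
    (measurable_gammaPDF a r) (by simp [gammaPDF])]
  simp only [id_eq, hdens]
  rw [integral_indicator measurableSet_Ici, integral_Ici_eq_integral_Ioi, integral_const_mul,
    Real.integral_rpow_mul_exp_neg_mul_Ioi ha hrt, one_sub_div hr.ne',
    Real.rpow_neg (by positivity), Real.div_rpow hrt.le hr.le,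
    Real.div_rpow zero_le_one hrt.le, Real.one_rpow]
  have := (Real.Gamma_pos_of_pos ha).ne'
  have := (Real.rpow_pos_of_pos hr a).ne'
  have := (Real.rpow_pos_of_pos hrt a).ne'
  field_simp

lemma Iio_subset_integrableExpSet_gammaMeasure {a r : ℝ} (ha : 0 < a) (hr : 0 < r) :
    Iio r ⊆ integrableExpSet id (gammaMeasure a r) := by
  intro t ht
  by_contra h
  have hpos : 0 < (1 - t / r) ^ (-a) :=
    Real.rpow_pos_of_pos (sub_pos.2 ((div_lt_one hr).2 ht)) _
  rw [← mgf_id_gammaMeasure ha hr ht, mgf_undef h] at hpos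
  exact hpos.false

/-- The complex moment generating function of the Gamma distribution, on the half-plane to the
left of its rate. -/
lemma complexMGF_id_gammaMeasure {a r : ℝ} (ha : 0 < a) (hr : 0 < r) {z : ℂ} (hz : z.re < r) :
    complexMGF id (gammaMeasure a r) z = (1 - z / r) ^ (-(a : ℂ)) := by
  have hre (w : ℂ) (hw : w.re < r) : 0 < (1 - w / r).re := by
    simpa [div_ofReal_re] using (div_lt_one hr).2 hw
  have hopen : IsOpen {w : ℂ | w.re < r} := isOpen_lt continuous_re continuous_const
  have hf : AnalyticOnNhd ℂ (complexMGF id (gammaMeasure a r)) {w | w.re < r} :=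
    fun w hw ↦ analyticAt_complexMGF
      (interior_maximal (Iio_subset_integrableExpSet_gammaMeasure ha hr) isOpen_Iio hw)
  have hg : AnalyticOnNhd ℂ (fun w : ℂ ↦ (1 - w / r) ^ (-(a : ℂ))) {w | w.re < r} := by
    refine DifferentiableOn.analyticOnNhd (fun w hw ↦ ?_) hopen
    have hbase : DifferentiableAt ℂ (fun w : ℂ ↦ 1 - w / r) w := by fun_prop
    exact (hbase.cpow (differentiableAt_const _) (Or.inl (hre w hw))).differentiableWithinAt
  refine hf.eqOn_of_preconnected_of_frequently_eq hg
    (convex_halfSpace_re_lt r).isPreconnected (z₀ := ((0 : ℝ) : ℂ)) (by simpa using hr) ?_ hz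
  have hreal : ∀ᶠ x : ℝ in 𝓝[≠] 0, complexMGF id (gammaMeasure a r) (x : ℂ) =
      (1 - (x : ℂ) / r) ^ (-(a : ℂ)) := by
    filter_upwards [nhdsWithin_le_nhds (Iio_mem_nhds hr)] with x hx
    rw [complexMGF_ofReal, mgf_id_gammaMeasure ha hr hx,
      ofReal_cpow (sub_nonneg.2 ((div_le_one hr).2 (le_of_lt hx)))]
    push_cast
    rfl
  have htend : Tendsto ((↑) : ℝ → ℂ) (𝓝[≠] 0) (𝓝[≠] ((0 : ℝ) : ℂ)) :=
    continuous_ofReal.continuousAt.continuousWithinAt.tendsto_nhdsWithin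
      fun x hx ↦ by simpa using hx
  exact htend.frequently hreal.frequently

lemma ae_nonneg_gammaMeasure (a r : ℝ) : ∀ᵐ x ∂gammaMeasure a r, 0 ≤ x := by
  rw [gammaMeasure, ae_withDensity_iff (measurable_gammaPDF a r)]
  refine ae_of_all _ fun x hx ↦ ?_
  by_contra! h
  exact hx (gammaPDF_of_neg h)

/-- If `W ∼ Gamma(λ, 1)` and `Z` is a centered Gaussian vector with covariance `S`,
independent of `W`, then `Y = W m + √W Z` has characteristic function
`t ↦ (1 + ½ tᵀ S t − i ⟨m, t⟩)^{−λ}` (principal power). -/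
theorem charFun_generalized_asymmetric_laplace {Ω : Type*} [MeasurableSpace Ω]
    (P : Measure Ω) [IsProbabilityMeasure P] {d : ℕ} {l : ℝ} (hl : 0 < l)
    (S : Matrix (Fin d) (Fin d) ℝ) (hS : S.PosSemidef) (m : Fin d → ℝ)
    (W : Ω → ℝ) (Z : Ω → Fin d → ℝ) (hWm : Measurable W) (hZm : Measurable Z)
    (hW : P.map W = gammaMeasure l 1)
    (hZ : IsCenteredGaussianLaw (P.map Z) S)
    (hindep : IndepFun W Z P)
    (Y : Ω → Fin d → ℝ) (hY : Y = fun ω => W ω • m + Real.sqrt (W ω) • Z ω) :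
    ∀ t : Fin d → ℝ,
      ∫ ω, Complex.exp (Complex.I * ((t ⬝ᵥ Y ω : ℝ) : ℂ)) ∂P =
        (1 + (1 / 2 : ℂ) * ((t ⬝ᵥ S.mulVec t : ℝ) : ℂ)
          - Complex.I * ((m ⬝ᵥ t : ℝ) : ℂ)) ^ (-(l : ℂ)) := by
  intro t
  subst hY
  obtain ⟨hprob, hchar⟩ := hZ
  have : IsProbabilityMeasure (gammaMeasure l 1) := isProbabilityMeasure_gammaMeasure hl one_pos
  let F : ℝ × (Fin d → ℝ) → ℂ := fun p ↦ cexp (I * ((t ⬝ᵥ (p.1 • m + √p.1 • p.2) : ℝ) : ℂ))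
  have hF : Continuous F := by
    unfold F dotProduct
    fun_prop
  have hFint : Integrable F ((gammaMeasure l 1).prod (P.map Z)) := by
    refine (integrable_const (1 : ℝ)).mono' hF.aestronglyMeasurable (ae_of_all _ fun p ↦ ?_)
    simp only [F]
    rw [mul_comm, norm_exp_ofReal_mul_I]
  set q : ℝ := t ⬝ᵥ S.mulVec t with hq
  have hq0 : 0 ≤ q := by simpa using hS.dotProduct_mulVec_nonneg t
  let z : ℂ := I * ((m ⬝ᵥ t : ℝ) : ℂ) - (1 / 2 : ℂ) * (q : ℂ)
  have hz : z.re < 1 := by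
    have : z.re = -(q / 2) := by simp [z]; ring
    linarith
  have hinner (w : ℝ) (hw : 0 ≤ w) : ∫ x, F (w, x) ∂(P.map Z) = cexp (z * (w : ℂ)) := by
    have hsplit (x : Fin d → ℝ) : F (w, x) = cexp (I * ((w * (m ⬝ᵥ t) : ℝ) : ℂ)) *
        cexp (I * (((√w • t) ⬝ᵥ x : ℝ) : ℂ)) := by
      simp only [F]
      rw [← Complex.exp_add, ← mul_add, ← ofReal_add, dotProduct_add, dotProduct_smul,
        dotProduct_smul, smul_dotProduct, dotProduct_comm t m, smul_eq_mul]
    simp only [hsplit]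
    rw [integral_const_mul, hchar, mulVec_smul, smul_dotProduct, dotProduct_smul, ← hq,
      smul_eq_mul, smul_eq_mul, ← mul_assoc, Real.mul_self_sqrt hw, ← Complex.exp_add]
    simp only [z]
    push_cast
    ring_nf
  calc ∫ ω, F (W ω, Z ω) ∂P
      = ∫ p, F p ∂((gammaMeasure l 1).prod (P.map Z)) := by
        rw [← hW, ← hindep.map_prod_eq_prod_map_map hWm.aemeasurable hZm.aemeasurable,
          integral_map (by fun_prop) hF.aestronglyMeasurable]
    _ = ∫ w, cexp (z * (w : ℂ)) ∂gammaMeasure l 1 := by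
        rw [integral_prod _ hFint]
        refine integral_congr_ae ?_
        filter_upwards [ae_nonneg_gammaMeasure l 1] with w hw using hinner w hw
    _ = (1 - z / (1 : ℝ)) ^ (-(l : ℂ)) := complexMGF_id_gammaMeasure hl one_pos hz
    _ = _ := by
        congr 1
        simp only [z]
        push_cast
        ring
end

section
/- Let S be a positive semidefinite real d×d matrix, m ∈ ℝ^d, let W be an exponential random variable with rate 1 and let Z be a centered multivariate Gaussian random vector in ℝ^d with covariance matrix S, with W and Z independent. Set Y = W·m + √W·Z. Then for all coordinates j, l: E[Y_j·Y_l] − E[Y_j]·E[Y_l] = S_{j,l} + m_j·m_l; that is, the variance-covariance matrix of Y equals S + m·mᵀ. -/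
open MeasureTheory ProbabilityTheory Matrix Complex

open Set in
lemma expMeasure_one_eq_withDensity :
    expMeasure 1 =
      (volume.restrict (Ioi (0 : ℝ))).withDensity fun x => ENNReal.ofReal (Real.exp (-x)) := by
  rw [Measure.restrict_congr_set (Ioi_ae_eq_Ici (μ := volume) (a := (0 : ℝ))),
    ← withDensity_indicator measurableSet_Ici]
  change volume.withDensity (exponentialPDF 1) = _
  congr 1
  ext x
  rw [exponentialPDF_eq]
  by_cases hx : 0 ≤ x <;> simp [hx]

lemma ae_pos_expMeasure_one : ∀ᵐ x ∂expMeasure 1, 0 < x := by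
  rw [expMeasure_one_eq_withDensity]
  exact (withDensity_absolutelyContinuous _ _).ae_le (ae_restrict_mem measurableSet_Ioi)

lemma integrable_rpow_expMeasure_one {a : ℝ} (ha : -1 < a) :
    Integrable (fun x : ℝ => x ^ a) (expMeasure 1) := by
  rw [expMeasure_one_eq_withDensity,
    integrable_withDensity_iff_integrable_smul' (by fun_prop) (by simp)]
  simpa [ENNReal.toReal_ofReal, Real.exp_nonneg, IntegrableOn] using
    Real.GammaIntegral_convergent (s := a + 1) (by linarith)

lemma integral_rpow_expMeasure_one {a : ℝ} (ha : -1 < a) :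
    ∫ x, x ^ a ∂expMeasure 1 = Real.Gamma (a + 1) := by
  rw [expMeasure_one_eq_withDensity,
    integral_withDensity_eq_integral_toReal_smul (by fun_prop) (by simp),
    Real.Gamma_eq_integral (by linarith)]
  simp [ENNReal.toReal_ofReal, Real.exp_nonneg]

namespace IsCenteredGaussianLaw

variable {ι : Type*} [Fintype ι] [DecidableEq ι] {μ : Measure (ι → ℝ)} {S : Matrix ι ι ℝ}

lemma map_toLp_eq_multivariateGaussian (h : IsCenteredGaussianLaw μ S) (hS : S.PosSemidef) :
    μ.map (WithLp.toLp 2) = multivariateGaussian 0 S := by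
  have := h.1
  have : IsProbabilityMeasure (μ.map (WithLp.toLp 2)) :=
    Measure.isProbabilityMeasure_map (by fun_prop)
  refine Measure.ext_of_charFun (funext fun t => ?_)
  rw [charFun_multivariateGaussian hS, charFun_apply,
    integral_map (by fun_prop) (by fun_prop)]
  convert h.2 t.ofLp using 2
  · ext x
    rw [mul_comm, EuclideanSpace.inner_eq_star_dotProduct]
    simp
  · simp
    ring

lemma map_ofLp_multivariateGaussian (h : IsCenteredGaussianLaw μ S) (hS : S.PosSemidef) :
    (multivariateGaussian 0 S).map WithLp.ofLp = μ := by
  rw [← h.map_toLp_eq_multivariateGaussian hS, Measure.map_map (by fun_prop) (by fun_prop)]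
  exact Measure.map_id

lemma memLp_eval (h : IsCenteredGaussianLaw μ S) (hS : S.PosSemidef) (i : ι) :
    MemLp (fun x => x i) 2 μ := by
  rw [← h.map_ofLp_multivariateGaussian hS,
    memLp_map_measure_iff (by exact (measurable_pi_apply i).aestronglyMeasurable) (by fun_prop)]
  exact IsGaussian.memLp_dual _ (EuclideanSpace.proj i) 2 (by simp)

lemma integral_eval (h : IsCenteredGaussianLaw μ S) (hS : S.PosSemidef) (i : ι) :
    ∫ x, x i ∂μ = 0 := by
  rw [← h.map_ofLp_multivariateGaussian hS,
    integral_map (by fun_prop) (by exact (measurable_pi_apply i).aestronglyMeasurable)]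
  have := (EuclideanSpace.proj (𝕜 := ℝ) i).integral_comp_id_comm
    (IsGaussian.integrable_id (μ := multivariateGaussian 0 S))
  simpa using this

lemma integral_eval_mul_eval (h : IsCenteredGaussianLaw μ S) (hS : S.PosSemidef) (i j : ι) :
    ∫ x, x i * x j ∂μ = S i j := by
  have := h.1
  have hcov : cov[fun x => x i, fun x => x j; μ] = S i j := by
    rw [← covariance_eval_multivariateGaussian (μ := 0) hS i j]
    nth_rw 1 [← h.map_ofLp_multivariateGaussian hS]
    rw [covariance_map (measurable_pi_apply i).aestronglyMeasurable
      (measurable_pi_apply j).aestronglyMeasurable (by fun_prop)]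
    rfl
  rw [covariance_eq_sub (h.memLp_eval hS i) (h.memLp_eval hS j)] at hcov
  simpa [h.integral_eval hS] using hcov

end IsCenteredGaussianLaw

/-- If `W ∼ Exp(1)` and `Z` is a centered Gaussian vector with covariance `S`,
independent of `W`, then the variance-covariance matrix of `Y = W m + √W Z`
equals `S + m mᵀ`. -/
theorem covariance_asymmetric_laplace {Ω : Type*} [MeasurableSpace Ω]
    (P : Measure Ω) [IsProbabilityMeasure P] {d : ℕ}
    (S : Matrix (Fin d) (Fin d) ℝ) (hS : S.PosSemidef) (m : Fin d → ℝ)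
    (W : Ω → ℝ) (Z : Ω → Fin d → ℝ) (hWm : Measurable W) (hZm : Measurable Z)
    (hW : P.map W = expMeasure 1)
    (hZ : IsCenteredGaussianLaw (P.map Z) S)
    (hindep : IndepFun W Z P)
    (Y : Ω → Fin d → ℝ) (hY : Y = fun ω => W ω • m + Real.sqrt (W ω) • Z ω) :
    ∀ j l : Fin d,
      (∫ ω, Y ω j * Y ω l ∂P) - (∫ ω, Y ω j ∂P) * (∫ ω, Y ω l ∂P) =
        S j l + m j * m l := by
  intro j l
  have hWpos : ∀ᵐ ω ∂P, 0 < W ω :=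
    ae_of_ae_map hWm.aemeasurable (hW ▸ ae_pos_expMeasure_one)
  have hWint {a : ℝ} (ha : -1 < a) : Integrable (fun ω => W ω ^ a) P :=
    (hW ▸ integrable_rpow_expMeasure_one ha :
      Integrable (fun x : ℝ => x ^ a) (P.map W)).comp_measurable hWm
  have hWval {a : ℝ} (ha : -1 < a) : ∫ ω, W ω ^ a ∂P = Real.Gamma (a + 1) := by
    rw [← integral_rpow_expMeasure_one ha, ← hW, integral_map (by fun_prop) (by fun_prop)]
  have hZLp (i : Fin d) : MemLp (fun ω => Z ω i) 2 P :=
    (hZ.memLp_eval hS i).comp_measurePreserving ⟨hZm, rfl⟩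
  have hZint (i : Fin d) : Integrable (fun ω => Z ω i) P := (hZLp i).integrable one_le_two
  have hZZint : Integrable (fun ω => Z ω j * Z ω l) P := (hZLp j).integrable_mul (hZLp l)
  have hZmean (i : Fin d) : ∫ ω, Z ω i ∂P = 0 := by
    rw [← hZ.integral_eval hS i,
      integral_map hZm.aemeasurable (measurable_pi_apply i).aestronglyMeasurable]
  have hZZmean : ∫ ω, Z ω j * Z ω l ∂P = S j l := by
    rw [← hZ.integral_eval_mul_eval hS j l, integral_map (by fun_prop) (by fun_prop)]
  have hind (a : ℝ) {g : (Fin d → ℝ) → ℝ} (hg : Measurable g) :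
      IndepFun (fun ω => W ω ^ a) (fun ω => g (Z ω)) P :=
    hindep.comp (φ := fun w : ℝ => w ^ a) (by fun_prop) hg
  have hprod {a : ℝ} (ha : -1 < a) {g : (Fin d → ℝ) → ℝ} (hg : Measurable g)
      (hgi : Integrable (fun ω => g (Z ω)) P) :
      Integrable (fun ω => W ω ^ a * g (Z ω)) P ∧
        ∫ ω, W ω ^ a * g (Z ω) ∂P = Real.Gamma (a + 1) * ∫ ω, g (Z ω) ∂P := by
    refine ⟨(hind a hg).integrable_mul (hWint ha) hgi, ?_⟩
    rw [(hind a hg).integral_fun_mul_eq_mul_integral (hWint ha).1 hgi.1, hWval ha]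
  have hYmean (i : Fin d) : ∫ ω, Y ω i ∂P = m i := by
    obtain ⟨hi, hv⟩ := hprod (a := 1 / 2) (by norm_num) (measurable_pi_apply i) (hZint i)
    calc ∫ ω, Y ω i ∂P = ∫ ω, (W ω ^ (1 : ℝ) * m i + W ω ^ (1 / 2 : ℝ) * Z ω i) ∂P := by
          simp [hY, Real.sqrt_eq_rpow]
      _ = m i := by
          rw [integral_add ((hWint (by norm_num)).mul_const _) hi, integral_mul_const,
            hWval (by norm_num), hv, hZmean, one_add_one_eq_two, Real.Gamma_two]
          ring
  have hYmul : ∫ ω, Y ω j * Y ω l ∂P = 2 * (m j * m l) + S j l := by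
    obtain ⟨hij, hvj⟩ := hprod (a := 3 / 2) (by norm_num) (measurable_pi_apply j) (hZint j)
    obtain ⟨hil, hvl⟩ := hprod (a := 3 / 2) (by norm_num) (measurable_pi_apply l) (hZint l)
    obtain ⟨hi, hv⟩ := hprod (a := 1) (by norm_num)
      ((measurable_pi_apply j).mul (measurable_pi_apply l)) hZZint
    simp only [Pi.mul_apply] at hi hv
    calc ∫ ω, Y ω j * Y ω l ∂P
        = ∫ ω, (W ω ^ (2 : ℝ) * (m j * m l) + W ω ^ (3 / 2 : ℝ) * Z ω j * m l
            + W ω ^ (3 / 2 : ℝ) * Z ω l * m j + W ω ^ (1 : ℝ) * (Z ω j * Z ω l)) ∂P := by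
          refine integral_congr_ae ?_
          filter_upwards [hWpos] with ω hω
          have hsq : √(W ω) * √(W ω) = W ω := Real.mul_self_sqrt hω.le
          have hpow : W ω ^ (3 / 2 : ℝ) = W ω * √(W ω) := by
            rw [Real.sqrt_eq_rpow, ← Real.rpow_one_add' hω.le (by norm_num)]
            norm_num
          simp only [hY, Pi.add_apply, Pi.smul_apply, smul_eq_mul, Real.rpow_one,
            Real.rpow_two, hpow]
          linear_combination Z ω j * Z ω l * hsq
      _ = 2 * (m j * m l) + S j l := by
          have h2 := (hWint (a := 2) (by norm_num)).mul_const (m j * m l)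
          have h3 := hij.mul_const (m l)
          have h4 := hil.mul_const (m j)
          rw [integral_add (by fun_prop) hi, integral_add (by fun_prop) h4,
            integral_add h2 h3, integral_mul_const, integral_mul_const, integral_mul_const,
            hWval (by norm_num), hvj, hvl, hv, hZmean, hZmean, hZZmean, one_add_one_eq_two,
            Real.Gamma_two, Real.Gamma_add_one two_ne_zero, Real.Gamma_two]
          ring
  rw [hYmul, hYmean, hYmean]
  ring
end

section
/- Let Σ be a real k×k matrix, Ψ a real n×n matrix, M a real k×n matrix, and let X be a random real k×n matrix (on some probability space) such that for every real k×n matrix T, E[exp(i·tr(Tᵀ X))] = 1 / (1 + ½·tr(Ψ Tᵀ Σ T) − i·tr(Mᵀ T)). Let D be a real m×k matrix and C a real n×p matrix. Then for every real m×p matrix T, E[exp(i·tr(Tᵀ (D X C)))] = 1 / (1 + ½·tr((Cᵀ Ψ C) Tᵀ (D Σ Dᵀ) T) − i·tr((D M C)ᵀ T)). -/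
open MeasureTheory ProbabilityTheory Matrix Complex

/-- The (pi-type) measurable space structure on real matrices. -/
instance matrixMeasurableSpace {m n : Type*} : MeasurableSpace (Matrix m n ℝ) :=
  MeasurableSpace.pi

/-- If the random `k × n` matrix `X` has the characteristic function of the matrix
variate asymmetric Laplace distribution `MAL(M, Σ, Ψ)`, then `D X C` has the
characteristic function of `MAL(D M C, D Σ Dᵀ, Cᵀ Ψ C)`. -/
theorem charFun_MAL_mul_left_right {Ω : Type*} [MeasurableSpace Ω]
    (P : Measure Ω) [IsProbabilityMeasure P] {k n m p : ℕ}
    (S : Matrix (Fin k) (Fin k) ℝ) (Ψ : Matrix (Fin n) (Fin n) ℝ)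
    (M : Matrix (Fin k) (Fin n) ℝ)
    (X : Ω → Matrix (Fin k) (Fin n) ℝ) (hXm : Measurable X)
    (hX : ∀ T : Matrix (Fin k) (Fin n) ℝ,
      ∫ ω, Complex.exp (Complex.I * ((Matrix.trace (Tᵀ * X ω) : ℝ) : ℂ)) ∂P =
        1 / (1 + (1 / 2 : ℂ) * ((Matrix.trace (Ψ * Tᵀ * S * T) : ℝ) : ℂ)
          - Complex.I * ((Matrix.trace (Mᵀ * T) : ℝ) : ℂ)))
    (D : Matrix (Fin m) (Fin k) ℝ) (C : Matrix (Fin n) (Fin p) ℝ) :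
    ∀ T : Matrix (Fin m) (Fin p) ℝ,
      ∫ ω, Complex.exp (Complex.I * ((Matrix.trace (Tᵀ * (D * X ω * C)) : ℝ) : ℂ)) ∂P =
        1 / (1 + (1 / 2 : ℂ) * ((Matrix.trace ((Cᵀ * Ψ * C) * Tᵀ * (D * S * Dᵀ) * T) : ℝ) : ℂ)
          - Complex.I * ((Matrix.trace ((D * M * C)ᵀ * T) : ℝ) : ℂ)) := by
  intro T
  have hleft : ∀ Y : Matrix (Fin k) (Fin n) ℝ,
      trace (Tᵀ * (D * Y * C)) = trace ((Dᵀ * T * Cᵀ)ᵀ * Y) := fun Y => by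
    simp only [transpose_mul, transpose_transpose, ← Matrix.mul_assoc]
    rw [trace_mul_comm]
    simp only [Matrix.mul_assoc]
  have hquad : trace ((Cᵀ * Ψ * C) * Tᵀ * (D * S * Dᵀ) * T) =
      trace (Ψ * (Dᵀ * T * Cᵀ)ᵀ * S * (Dᵀ * T * Cᵀ)) := by
    simp only [transpose_mul, transpose_transpose, Matrix.mul_assoc]
    rw [trace_mul_comm]
    simp only [Matrix.mul_assoc]
  have hlin : trace ((D * M * C)ᵀ * T) = trace (Mᵀ * (Dᵀ * T * Cᵀ)) := by
    simp only [transpose_mul, Matrix.mul_assoc]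
    rw [trace_mul_comm]
    simp only [Matrix.mul_assoc]
  simp only [hleft, hquad, hlin]
  exact hX _
end

section
/- Let λ > 0, Σ a real k×k matrix, Ψ a real n×n matrix, M a real k×n matrix, and let X be a random real k×n matrix (on some probability space) such that for every real k×n matrix T, E[exp(i·tr(Tᵀ X))] = (1 + ½·tr(Ψ Tᵀ Σ T) − i·tr(Mᵀ T))^{−λ} (principal power, the base having positive real part). Let D be a real m×k matrix and C a real n×p matrix. Then for every real m×p matrix T, E[exp(i·tr(Tᵀ (D X C)))] = (1 + ½·tr((Cᵀ Ψ C) Tᵀ (D Σ Dᵀ) T) − i·tr((D M C)ᵀ T))^{−λ}. -/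
open MeasureTheory ProbabilityTheory Matrix Complex

/-- If the random `k × n` matrix `X` has the characteristic function of the matrix
variate generalized asymmetric Laplace distribution `MGAL(M, Σ, Ψ, λ)`, then `D X C` has the
characteristic function of `MGAL(D M C, D Σ Dᵀ, Cᵀ Ψ C, λ)` (principal powers). -/
theorem charFun_MGAL_mul_left_right {Ω : Type*} [MeasurableSpace Ω]
    (P : Measure Ω) [IsProbabilityMeasure P] {k n m p : ℕ} {lam : ℝ} (hlam : 0 < lam)
    (S : Matrix (Fin k) (Fin k) ℝ) (Ψ : Matrix (Fin n) (Fin n) ℝ)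
    (M : Matrix (Fin k) (Fin n) ℝ)
    (X : Ω → Matrix (Fin k) (Fin n) ℝ) (hXm : Measurable X)
    (hX : ∀ T : Matrix (Fin k) (Fin n) ℝ,
      ∫ ω, Complex.exp (Complex.I * ((Matrix.trace (Tᵀ * X ω) : ℝ) : ℂ)) ∂P =
        (1 + (1 / 2 : ℂ) * ((Matrix.trace (Ψ * Tᵀ * S * T) : ℝ) : ℂ)
          - Complex.I * ((Matrix.trace (Mᵀ * T) : ℝ) : ℂ)) ^ (-(lam : ℂ)))
    (D : Matrix (Fin m) (Fin k) ℝ) (C : Matrix (Fin n) (Fin p) ℝ) :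
    ∀ T : Matrix (Fin m) (Fin p) ℝ,
      ∫ ω, Complex.exp (Complex.I * ((Matrix.trace (Tᵀ * (D * X ω * C)) : ℝ) : ℂ)) ∂P =
        (1 + (1 / 2 : ℂ) * ((Matrix.trace ((Cᵀ * Ψ * C) * Tᵀ * (D * S * Dᵀ) * T) : ℝ) : ℂ)
          - Complex.I * ((Matrix.trace ((D * M * C)ᵀ * T) : ℝ) : ℂ)) ^ (-(lam : ℂ)) := by
  intro T
  have hT : (Dᵀ * T * Cᵀ)ᵀ = C * (Tᵀ * D) := by
    simp only [Matrix.transpose_mul, Matrix.transpose_transpose]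
  have hchar (A : Matrix (Fin k) (Fin n) ℝ) :
      Matrix.trace (Tᵀ * (D * A * C)) = Matrix.trace ((Dᵀ * T * Cᵀ)ᵀ * A) := by
    rw [hT, Matrix.mul_assoc C, Matrix.trace_mul_comm C]
    simp only [Matrix.mul_assoc]
  have hquad : Matrix.trace ((Cᵀ * Ψ * C) * Tᵀ * (D * S * Dᵀ) * T) =
      Matrix.trace (Ψ * (Dᵀ * T * Cᵀ)ᵀ * S * (Dᵀ * T * Cᵀ)) := by
    rw [hT, ← Matrix.mul_assoc _ (Dᵀ * T), Matrix.trace_mul_comm _ Cᵀ]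
    simp only [Matrix.mul_assoc]
  have hlin : Matrix.trace ((D * M * C)ᵀ * T) = Matrix.trace (Mᵀ * (Dᵀ * T * Cᵀ)) := by
    rw [← Matrix.mul_assoc, Matrix.trace_mul_comm _ Cᵀ]
    simp only [Matrix.transpose_mul, Matrix.mul_assoc]
  simp only [hchar, hquad, hlin]
  exact hX (Dᵀ * T * Cᵀ)
end

section
/- Let Σ be a real k×k matrix, Ψ a real n×n matrix, M a real k×n matrix, and let X be a random real k×n matrix such that for every real k×n matrix T, E[exp(i·tr(Tᵀ X))] = 1 / (1 + ½·tr(Ψ Tᵀ Σ T) − i·tr(Mᵀ T)). Let C be a real n×p matrix. Then for every real k×p matrix T, E[exp(i·tr(Tᵀ (X C)))] = 1 / (1 + ½·tr((Cᵀ Ψ C) Tᵀ Σ T) − i·tr((M C)ᵀ T)). -/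
open MeasureTheory ProbabilityTheory Matrix Complex

/-- If the random `k × n` matrix `X` has the characteristic function of the matrix
variate asymmetric Laplace distribution `MAL(M, Σ, Ψ)`, then `X C` has the
characteristic function of `MAL(M C, Σ, Cᵀ Ψ C)`. -/
theorem charFun_MAL_mul_right {Ω : Type*} [MeasurableSpace Ω]
    (P : Measure Ω) [IsProbabilityMeasure P] {k n p : ℕ}
    (S : Matrix (Fin k) (Fin k) ℝ) (Ψ : Matrix (Fin n) (Fin n) ℝ)
    (M : Matrix (Fin k) (Fin n) ℝ)
    (X : Ω → Matrix (Fin k) (Fin n) ℝ) (hXm : Measurable X)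
    (hX : ∀ T : Matrix (Fin k) (Fin n) ℝ,
      ∫ ω, Complex.exp (Complex.I * ((Matrix.trace (Tᵀ * X ω) : ℝ) : ℂ)) ∂P =
        1 / (1 + (1 / 2 : ℂ) * ((Matrix.trace (Ψ * Tᵀ * S * T) : ℝ) : ℂ)
          - Complex.I * ((Matrix.trace (Mᵀ * T) : ℝ) : ℂ)))
    (C : Matrix (Fin n) (Fin p) ℝ) :
    ∀ T : Matrix (Fin k) (Fin p) ℝ,
      ∫ ω, Complex.exp (Complex.I * ((Matrix.trace (Tᵀ * (X ω * C)) : ℝ) : ℂ)) ∂P =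
        1 / (1 + (1 / 2 : ℂ) * ((Matrix.trace ((Cᵀ * Ψ * C) * Tᵀ * S * T) : ℝ) : ℂ)
          - Complex.I * ((Matrix.trace ((M * C)ᵀ * T) : ℝ) : ℂ)) := by
  intro T
  have h := hX (T * Cᵀ)
  have hexp (Y : Matrix (Fin k) (Fin n) ℝ) :
      trace ((T * Cᵀ)ᵀ * Y) = trace (Tᵀ * (Y * C)) := by
    rw [transpose_mul, transpose_transpose, Matrix.mul_assoc, trace_mul_comm, Matrix.mul_assoc]
  have hquad : trace (Ψ * (T * Cᵀ)ᵀ * S * (T * Cᵀ)) =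
      trace ((Cᵀ * Ψ * C) * Tᵀ * S * T) := by
    rw [transpose_mul, transpose_transpose, ← Matrix.mul_assoc _ T, trace_mul_comm]
    simp only [Matrix.mul_assoc]
  have hlin : trace (Mᵀ * (T * Cᵀ)) = trace ((M * C)ᵀ * T) := by
    rw [transpose_mul, ← Matrix.mul_assoc, trace_mul_comm, Matrix.mul_assoc]
  simpa only [hexp, hquad, hlin] using h
end
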